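/- Suppose Assumptions 1 and 2 hold. Then there exist class-K∞ functions α₁, α₂, α₃ such that the Lur'e–Postnikov function V(x) = (1/2)xᵀPx + Σᵢ γᵢ ∫₀^{Cᵢx} ψᵢ(σ)dσ satisfies α₁(|x|) ≤ V(x) ≤ α₂(|x|) for all x ∈ ℝⁿ, and for every x ∈ ℝⁿ every element a of the set-valued Lie derivative D̄V_F(x) satisfies a ≤ −α₃(V(x)). -/

import Mathlib

open Matrix MeasureTheory Filter Set
open scoped ENNReal

noncomputable section

/-- Euclidean norm on `Fin m → ℝ`. -/
def euclNorm {m : ℕ} (x : Fin m → ℝ) : ℝ := Real.sqrt (∑ i, x i ^ 2)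

/-- Krasovskii regularization of a scalar function `ψ` at `y`:
`Ψ(y) = ⋂_{δ>0} closure (convexHull (ψ '' [y-δ, y+δ]))`. -/
def kras (ψ : ℝ → ℝ) (y : ℝ) : Set ℝ :=
  ⋂ δ ∈ Set.Ioi (0 : ℝ), closure (convexHull ℝ (ψ '' Set.Icc (y - δ) (y + δ)))

/-- Product (decentralized) Krasovskii regularization `ΨΨ(y) = Ψ₁(y₁) × ⋯ × Ψ_p(y_p)`. -/
def PsiSet {p : ℕ} (ψ : Fin p → ℝ → ℝ) (y : Fin p → ℝ) : Set (Fin p → ℝ) :=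
  {w | ∀ i, w i ∈ kras (ψ i) (y i)}

/-- The regularized Lur'e set-valued dynamics `F(x) = {Ax + Bu : u ∈ -ΨΨ(Cx)}`. -/
def lureF {n p : ℕ} (A : Matrix (Fin n) (Fin n) ℝ) (B : Matrix (Fin n) (Fin p) ℝ)
    (C : Matrix (Fin p) (Fin n) ℝ) (ψ : Fin p → ℝ → ℝ) (x : Fin n → ℝ) :
    Set (Fin n → ℝ) :=
  {f | ∃ u : Fin p → ℝ, (fun i => -u i) ∈ PsiSet ψ (C.mulVec x) ∧
        f = A.mulVec x + B.mulVec u}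

/-- Piecewise continuity: finitely many discontinuity points on every compact
interval, and finite one-sided limits at every point. -/
def PiecewiseContinuous (f : ℝ → ℝ) : Prop :=
  (∀ a b : ℝ, {s ∈ Set.Icc a b | ¬ ContinuousAt f s}.Finite) ∧
  (∀ x : ℝ, (∃ L : ℝ, Tendsto f (nhdsWithin x (Set.Ioi x)) (nhds L)) ∧
    (∃ L : ℝ, Tendsto f (nhdsWithin x (Set.Iio x)) (nhds L)))

/-- Sector condition: there is `ζ = 1/z ∈ (0, +∞]` (with `z = ζ⁻¹ ≥ 0`, `z = 0`
corresponding to `ζ = +∞`) such that `ψ(s)(ψ(s) - ζ s) ≤ 0` for all `s`. -/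
def Sector (ψ : ℝ → ℝ) (z : ℝ) : Prop :=
  (z = 0 ∧ ∀ s : ℝ, 0 ≤ s * ψ s) ∨
  (0 < z ∧ ∀ s : ℝ, ψ s * (ψ s - (1 / z) * s) ≤ 0)

/-- Class `KL` functions. -/
def ClassKL (β : ℝ → ℝ → ℝ) : Prop :=
  (∀ t : ℝ, 0 ≤ t → ContinuousOn (fun s => β s t) (Set.Ici 0) ∧
    StrictMonoOn (fun s => β s t) (Set.Ici 0) ∧ β 0 t = 0) ∧
  (∀ s : ℝ, 0 ≤ s → AntitoneOn (fun t => β s t) (Set.Ici 0) ∧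
    Tendsto (fun t => β s t) atTop (nhds 0))

/-- Class `K∞` functions. -/
def ClassKInf (α : ℝ → ℝ) : Prop :=
  ContinuousOn α (Set.Ici 0) ∧ StrictMonoOn α (Set.Ici 0) ∧ α 0 = 0 ∧
  Tendsto α atTop atTop

/-- A Krasovskii solution of `ẋ ∈ F(x)` on a time set `s` (a locally absolutely
continuous function whose derivative belongs to `F(x(t))` almost everywhere),
formalized through the integral representation `x(t) = x(0) + ∫₀ᵗ f(τ) dτ`
with `f(τ) ∈ F(x(τ))` for a.e. `τ ∈ s`. -/
def IsKrasovskiiSolutionOn {n : ℕ} (F : (Fin n → ℝ) → Set (Fin n → ℝ))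
    (x : ℝ → Fin n → ℝ) (s : Set ℝ) : Prop :=
  ∃ f : ℝ → Fin n → ℝ,
    (∀ t ∈ s, IntervalIntegrable f volume 0 t) ∧
    (∀ᵐ t ∂volume, t ∈ s → f t ∈ F (x t)) ∧
    ∀ t ∈ s, x t = x 0 + ∫ τ in (0:ℝ)..t, f τ

/-- The time interval `[0, T)` with `T ∈ (0, +∞]`. -/
def timeItv (T : ℝ≥0∞) : Set ℝ := {t : ℝ | 0 ≤ t ∧ ENNReal.ofReal t < T}

/-- Global asymptotic stability of the origin: a class-`KL` bound holds along
every Krasovskii solution on every time interval `[0, T)`. -/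
def GASOrigin {n p : ℕ} (A : Matrix (Fin n) (Fin n) ℝ) (B : Matrix (Fin n) (Fin p) ℝ)
    (C : Matrix (Fin p) (Fin n) ℝ) (ψ : Fin p → ℝ → ℝ) : Prop :=
  ∃ β : ℝ → ℝ → ℝ, ClassKL β ∧
    ∀ T : ℝ≥0∞, ∀ x : ℝ → Fin n → ℝ,
      IsKrasovskiiSolutionOn (lureF A B C ψ) x (timeItv T) →
      ∀ t ∈ timeItv T, euclNorm (x t) ≤ β (euclNorm (x 0)) t

/-- Clarke generalized gradient of the Lur'e–Postnikov function:
`∂V(x) = {Px + CᵀΓw : w ∈ ΨΨ(Cx)}`. -/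
def clarkeGrad {n p : ℕ} (P : Matrix (Fin n) (Fin n) ℝ) (C : Matrix (Fin p) (Fin n) ℝ)
    (Γ : Matrix (Fin p) (Fin p) ℝ) (ψ : Fin p → ℝ → ℝ) (x : Fin n → ℝ) :
    Set (Fin n → ℝ) :=
  {v | ∃ w ∈ PsiSet ψ (C.mulVec x), v = P.mulVec x + (Cᵀ * Γ).mulVec w}

/-- Set-valued Lie derivative of the Lur'e–Postnikov function with respect to
the regularized Lur'e dynamics `F`. -/
def lieDeriv {n p : ℕ} (A : Matrix (Fin n) (Fin n) ℝ) (B : Matrix (Fin n) (Fin p) ℝ)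
    (C : Matrix (Fin p) (Fin n) ℝ) (ψ : Fin p → ℝ → ℝ)
    (P : Matrix (Fin n) (Fin n) ℝ) (Γ : Matrix (Fin p) (Fin p) ℝ)
    (x : Fin n → ℝ) : Set ℝ :=
  {a | ∃ f ∈ lureF A B C ψ x, ∀ v ∈ clarkeGrad P C Γ ψ x, v ⬝ᵥ f = a}

/-- The Lur'e–Postnikov function
`V(x) = (1/2) xᵀPx + Σᵢ γᵢ ∫₀^{Cᵢx} ψᵢ(σ) dσ`. -/
def lureV {n p : ℕ} (P : Matrix (Fin n) (Fin n) ℝ) (C : Matrix (Fin p) (Fin n) ℝ)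
    (γ : Fin p → ℝ) (ψ : Fin p → ℝ → ℝ) (x : Fin n → ℝ) : ℝ :=
  (1 / 2) * (x ⬝ᵥ P.mulVec x) + ∑ i, γ i * ∫ σ in (0:ℝ)..(C.mulVec x i), ψ i σ

theorem PiecewiseContinuous.locallyIntegrable {f : ℝ → ℝ} (hf : PiecewiseContinuous f) :
    LocallyIntegrable f volume := by
  have hD : {s | ¬ ContinuousAt f s}.Countable := by
    refine (countable_iUnion fun N : ℕ => (hf.1 (-N) N).countable).mono fun s hs => ?_
    obtain ⟨N, hN⟩ := exists_nat_ge |s|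
    exact mem_iUnion.2 ⟨N, abs_le.1 hN, hs⟩
  have hmeas : AEStronglyMeasurable f volume := by
    have hc : ContinuousOn f {s | ¬ ContinuousAt f s}ᶜ := fun s hs =>
      (not_not.1 hs : ContinuousAt f s).continuousWithinAt
    have h := hc.aestronglyMeasurable (μ := volume) hD.measurableSet.compl
    have hr : volume.restrict {s | ¬ ContinuousAt f s}ᶜ = volume :=
      Measure.restrict_eq_self_of_ae_mem (hD.ae_notMem volume)
    rwa [hr] at h
  intro x
  obtain ⟨⟨L, hL⟩, L', hL'⟩ := hf.2 x
  have hr : IntegrableAtFilter f (nhdsWithin x (Ioi x)) volume :=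
    (volume.finiteAt_nhdsWithin x _).integrableAtFilter_of_tendsto
      hmeas.stronglyMeasurableAtFilter hL
  have hl : IntegrableAtFilter f (nhdsWithin x (Iio x)) volume :=
    (volume.finiteAt_nhdsWithin x _).integrableAtFilter_of_tendsto
      hmeas.stronglyMeasurableAtFilter hL'
  have hp : IntegrableAtFilter f (pure x) volume :=
    ⟨{x}, by simp, integrableOn_singleton (hx := measure_singleton_lt_top)⟩
  rw [← nhdsNE_sup_pure, ← nhdsLT_sup_nhdsGT, IntegrableAtFilter.sup_iff,
    IntegrableAtFilter.sup_iff]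
  exact ⟨⟨hl, hr⟩, hp⟩

theorem PiecewiseContinuous.intervalIntegrable {f : ℝ → ℝ} (hf : PiecewiseContinuous f)
    (a b : ℝ) : IntervalIntegrable f volume a b :=
  (hf.locallyIntegrable.integrableOn_isCompact isCompact_uIcc).intervalIntegrable

theorem Sector.nonneg {ψ : ℝ → ℝ} {z : ℝ} (h : Sector ψ z) : 0 ≤ z := by
  rcases h with h | h
  · exact h.1.ge
  · exact h.1.le

theorem Sector.of_pos {ψ : ℝ → ℝ} {z s : ℝ} (h : Sector ψ z) (hs : 0 < s) :
    0 ≤ ψ s ∧ z * ψ s ≤ s := by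
  rcases h with ⟨rfl, h⟩ | ⟨hz, h⟩
  · exact ⟨nonneg_of_mul_nonneg_right (h s) hs, by simpa using hs.le⟩
  · have h' : ψ s * (z * ψ s - s) ≤ 0 := by
      have := mul_nonpos_of_nonneg_of_nonpos hz.le (h s)
      calc ψ s * (z * ψ s - s) = z * (ψ s * (ψ s - 1 / z * s)) := by field_simp
        _ ≤ 0 := this
    constructor
    · by_contra! hn
      nlinarith [mul_pos hz (mul_pos_of_neg_of_neg hn hn), mul_neg_of_neg_of_pos hn hs]
    · by_contra! hn
      have : 0 < ψ s := pos_of_mul_pos_right (hs.trans hn) hz.le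
      nlinarith [mul_pos this (sub_pos.2 hn)]

theorem Sector.neg {ψ : ℝ → ℝ} {z : ℝ} (h : Sector ψ z) : Sector (fun s => -ψ (-s)) z := by
  rcases h with ⟨hz, h⟩ | ⟨hz, h⟩
  · exact Or.inl ⟨hz, fun s => by have := h (-s); linarith⟩
  · exact Or.inr ⟨hz, fun s => by have := h (-s); linarith⟩

theorem Sector.of_neg {ψ : ℝ → ℝ} {z s : ℝ} (h : Sector ψ z) (hs : s < 0) :
    ψ s ≤ 0 ∧ s ≤ z * ψ s := by
  have := h.neg.of_pos (neg_pos.2 hs)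
  simp only [neg_neg] at this
  constructor <;> linarith

theorem kras_subset_of_image_subset {ψ : ℝ → ℝ} {y δ : ℝ} {K : Set ℝ} (hδ : 0 < δ)
    (hK : IsClosed K) (hKc : Convex ℝ K) (h : ∀ s ∈ Icc (y - δ) (y + δ), ψ s ∈ K) :
    kras ψ y ⊆ K := fun _ hw =>
  closure_minimal (convexHull_min (image_subset_iff.2 h) hKc) hK (mem_iInter₂.1 hw δ hδ)

theorem convex_setOf_mul_le (z c : ℝ) : Convex ℝ {w : ℝ | z * w ≤ c} :=
  convex_halfSpace_le (IsLinearMap.isLinearMap_smul z) c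

theorem convex_setOf_le_mul (z c : ℝ) : Convex ℝ {w : ℝ | c ≤ z * w} :=
  convex_halfSpace_ge (IsLinearMap.isLinearMap_smul z) c

/-- The sector condition is inherited by the Krasovskii regularization. -/
theorem Sector.kras {ψ : ℝ → ℝ} {z y w : ℝ} (h : Sector ψ z) (hw : w ∈ kras ψ y) :
    w * (z * w - y) ≤ 0 := by
  have hz := h.nonneg
  have hzero (hzp : 0 < z) : ψ 0 = 0 := by
    rcases h with ⟨rfl, -⟩ | ⟨-, h⟩
    · exact absurd hzp (lt_irrefl _)
    · have := h 0
      simp only [mul_zero, sub_zero] at this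
      exact mul_self_eq_zero.1 (this.antisymm (mul_self_nonneg _))
  have hle (s : ℝ) (hs : 0 ≤ s) : z * ψ s ≤ s := by
    rcases hs.eq_or_lt with rfl | hs
    · rcases hz.eq_or_lt with rfl | hz
      · simp
      · simp [hzero hz]
    · exact (h.of_pos hs).2
  have hge (s : ℝ) (hs : s ≤ 0) : s ≤ z * ψ s := by
    rcases hs.eq_or_lt with rfl | hs
    · rcases hz.eq_or_lt with rfl | hz
      · simp
      · simp [hzero hz]
    · exact (h.of_neg hs).2
  have hup (hy : 0 ≤ y) : z * w ≤ y := by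
    refine le_of_forall_pos_le_add fun δ hδ => ?_
    refine kras_subset_of_image_subset hδ (isClosed_le (by fun_prop) continuous_const)
      (convex_setOf_mul_le z (y + δ)) (fun s hs => ?_) hw
    rcases le_total 0 s with h0 | h0
    · exact (hle s h0).trans hs.2
    · rcases h0.eq_or_lt with rfl | h0
      · exact (hle 0 le_rfl).trans hs.2
      · exact (mul_nonpos_of_nonneg_of_nonpos hz (h.of_neg h0).1).trans (by linarith)
  have hlow (hy : y ≤ 0) : y ≤ z * w := by
    refine le_of_forall_pos_sub_le fun δ hδ => ?_
    refine kras_subset_of_image_subset hδ (isClosed_le continuous_const (by fun_prop))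
      (convex_setOf_le_mul z (y - δ)) (fun s hs => ?_) hw
    rcases le_total s 0 with h0 | h0
    · exact hs.1.trans (hge s h0)
    · rcases h0.eq_or_lt with rfl | h0
      · exact hs.1.trans (hge 0 le_rfl)
      · exact le_trans (by linarith) (mul_nonneg hz (h.of_pos h0).1)
  rcases lt_trichotomy y 0 with hy | rfl | hy
  · have : w ≤ 0 := kras_subset_of_image_subset (K := Iic 0) (δ := -y / 2) (by linarith)
      isClosed_Iic (convex_Iic 0)
      (fun s hs => (h.of_neg (by linarith [hs.2])).1) hw
    exact mul_nonpos_of_nonpos_of_nonneg this (sub_nonneg.2 (hlow hy.le))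
  · rw [le_antisymm (hup le_rfl) (hlow le_rfl)]
    simp
  · have : 0 ≤ w := kras_subset_of_image_subset (K := Ici 0) (δ := y / 2) (by linarith)
      isClosed_Ici (convex_Ici 0)
      (fun s hs => (h.of_pos (by linarith [hs.1])).1) hw
    exact mul_nonpos_of_nonneg_of_nonpos this (sub_nonpos.2 (hup hy.le))

theorem Sector.integral_nonneg {ψ : ℝ → ℝ} {z a b : ℝ} (h : Sector ψ z) (ha : 0 ≤ a)
    (hab : a ≤ b) : 0 ≤ ∫ s in a..b, ψ s := by
  rw [intervalIntegral.integral_of_le hab]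
  exact setIntegral_nonneg measurableSet_Ioc fun s hs => (h.of_pos (ha.trans_lt hs.1)).1

theorem Sector.integral_neg_nonneg {ψ : ℝ → ℝ} {z a b : ℝ} (h : Sector ψ z) (ha : 0 ≤ a)
    (hab : a ≤ b) : 0 ≤ ∫ s in -a..-b, ψ s := by
  have := h.neg.integral_nonneg ha hab
  rw [intervalIntegral.integral_neg, intervalIntegral.integral_comp_neg,
    ← intervalIntegral.integral_symm] at this
  exact this

theorem Sector.integral_mono {ψ : ℝ → ℝ} {z a b : ℝ} (h : Sector ψ z)
    (hψ : ∀ a b, IntervalIntegrable ψ volume a b) (ha : 0 ≤ a) (hab : a ≤ b) :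
    ∫ s in (0 : ℝ)..a, ψ s ≤ ∫ s in (0 : ℝ)..b, ψ s := by
  rw [← intervalIntegral.integral_add_adjacent_intervals (hψ _ a)
    (hψ _ b)]
  linarith [h.integral_nonneg ha hab]

theorem Sector.integral_neg_mono {ψ : ℝ → ℝ} {z a b : ℝ} (h : Sector ψ z)
    (hψ : ∀ a b, IntervalIntegrable ψ volume a b) (ha : 0 ≤ a) (hab : a ≤ b) :
    ∫ s in (0 : ℝ)..-a, ψ s ≤ ∫ s in (0 : ℝ)..-b, ψ s := by
  rw [← intervalIntegral.integral_add_adjacent_intervals (hψ _ (-a))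
    (hψ _ (-b))]
  linarith [h.integral_neg_nonneg ha hab]

theorem Sector.primitive_nonneg {ψ : ℝ → ℝ} {z : ℝ} (h : Sector ψ z) (y : ℝ) :
    0 ≤ ∫ s in (0 : ℝ)..y, ψ s := by
  rcases le_total 0 y with hy | hy
  · exact h.integral_nonneg le_rfl hy
  · simpa using h.integral_neg_nonneg le_rfl (neg_nonneg.2 hy)

theorem Sector.primitive_le {ψ : ℝ → ℝ} {z y r : ℝ} (h : Sector ψ z)
    (hψ : ∀ a b, IntervalIntegrable ψ volume a b) (hy : |y| ≤ r) :
    ∫ s in (0 : ℝ)..y, ψ s ≤ (∫ s in (0 : ℝ)..r, ψ s) + ∫ s in (0 : ℝ)..-r, ψ s := by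
  rcases le_total 0 y with h0 | h0
  · rw [abs_of_nonneg h0] at hy
    linarith [h.integral_mono hψ h0 hy, h.primitive_nonneg (-r)]
  · rw [abs_of_nonpos h0] at hy
    have := h.integral_neg_mono hψ (neg_nonneg.2 h0) hy
    rw [neg_neg] at this
    linarith [h.primitive_nonneg r]

theorem euclNorm_nonneg {m : ℕ} (x : Fin m → ℝ) : 0 ≤ euclNorm x := Real.sqrt_nonneg _

theorem euclNorm_sq {m : ℕ} (x : Fin m → ℝ) : euclNorm x ^ 2 = x ⬝ᵥ x := by
  rw [euclNorm, Real.sq_sqrt (Finset.sum_nonneg fun i _ => sq_nonneg _)]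
  simp [dotProduct, sq]

theorem abs_le_euclNorm {m : ℕ} (x : Fin m → ℝ) (i : Fin m) : |x i| ≤ euclNorm x :=
  Real.abs_le_sqrt (Finset.single_le_sum (f := fun i => x i ^ 2)
    (fun _ _ => sq_nonneg _) (Finset.mem_univ i))

theorem abs_mulVec_le {m k : ℕ} (C : Matrix (Fin k) (Fin m) ℝ) (x : Fin m → ℝ) (i : Fin k) :
    |C.mulVec x i| ≤ (∑ i, ∑ j, |C i j|) * euclNorm x := by
  calc |C.mulVec x i| = |∑ j, C i j * x j| := rfl
    _ ≤ ∑ j, |C i j * x j| := Finset.abs_sum_le_sum_abs _ _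
    _ ≤ ∑ j, |C i j| * euclNorm x := Finset.sum_le_sum fun j _ => by
        rw [abs_mul]
        exact mul_le_mul_of_nonneg_left (abs_le_euclNorm x j) (abs_nonneg _)
    _ = (∑ j, |C i j|) * euclNorm x := by rw [Finset.sum_mul]
    _ ≤ _ := mul_le_mul_of_nonneg_right
        (Finset.single_le_sum (f := fun i => ∑ j, |C i j|)
          (fun _ _ => Finset.sum_nonneg fun _ _ => abs_nonneg _) (Finset.mem_univ i))
        (euclNorm_nonneg x)

theorem dotProduct_mulVec_le {m : ℕ} (P : Matrix (Fin m) (Fin m) ℝ) (x : Fin m → ℝ) :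
    x ⬝ᵥ P.mulVec x ≤ (m * ∑ i, ∑ j, |P i j|) * euclNorm x ^ 2 := by
  calc x ⬝ᵥ P.mulVec x
      ≤ ∑ _i : Fin m, euclNorm x * ((∑ i, ∑ j, |P i j|) * euclNorm x) :=
        Finset.sum_le_sum fun i _ => (le_abs_self _).trans <| by
          rw [abs_mul]
          exact mul_le_mul (abs_le_euclNorm x i) (abs_mulVec_le P x i) (abs_nonneg _)
            (euclNorm_nonneg x)
    _ = _ := by
        rw [Finset.sum_const, Finset.card_univ, Fintype.card_fin, nsmul_eq_mul]
        ring

theorem Matrix.PosDef.exists_pos_mul_euclNorm_sq_le {m : ℕ} {P : Matrix (Fin m) (Fin m) ℝ}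
    (hP : P.PosDef) : ∃ c > 0, ∀ x : Fin m → ℝ, c * euclNorm x ^ 2 ≤ x ⬝ᵥ P.mulVec x := by
  have hcont : Continuous fun x : Fin m → ℝ => x ⬝ᵥ P.mulVec x := by fun_prop
  have hcompact : IsCompact {x : Fin m → ℝ | x ⬝ᵥ x = 1} := by
    refine Metric.isCompact_of_isClosed_isBounded
      (isClosed_eq (by fun_prop) continuous_const)
      ((Metric.isBounded_closedBall (x := 0) (r := 1)).subset fun x hx => ?_)
    rw [mem_closedBall_zero_iff, pi_norm_le_iff_of_nonneg zero_le_one]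
    intro i
    have h1 : euclNorm x ^ 2 = 1 := (euclNorm_sq x).trans hx
    have h2 : euclNorm x = 1 := by
      nlinarith [euclNorm_nonneg x]
    exact (abs_le_euclNorm x i).trans h2.le
  obtain ⟨c, hc, hbound⟩ : ∃ c > 0, ∀ x : Fin m → ℝ, x ⬝ᵥ x = 1 → c ≤ x ⬝ᵥ P.mulVec x := by
    rcases {x : Fin m → ℝ | x ⬝ᵥ x = 1}.eq_empty_or_nonempty with he | hne
    · exact ⟨1, one_pos, fun x hx => absurd hx (he ▸ notMem_empty x :)⟩
    · obtain ⟨x₀, hx₀, hmin⟩ := hcompact.exists_isMinOn hne hcont.continuousOn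
      have hx₀ne : x₀ ≠ 0 := by
        rintro rfl
        simp at hx₀
      exact ⟨_, by simpa using hP.dotProduct_mulVec_pos hx₀ne, fun x hx => hmin hx⟩
  refine ⟨c, hc, fun x => ?_⟩
  rcases eq_or_ne (euclNorm x) 0 with h0 | h0
  · rw [h0]
    simpa using hP.posSemidef.dotProduct_mulVec_nonneg x
  · have hunit : ((euclNorm x)⁻¹ • x) ⬝ᵥ ((euclNorm x)⁻¹ • x) = 1 := by
      rw [smul_dotProduct, dotProduct_smul, ← euclNorm_sq, smul_eq_mul, smul_eq_mul]
      field_simp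
    have h := hbound _ hunit
    rw [mulVec_smul, smul_dotProduct, dotProduct_smul, smul_eq_mul, smul_eq_mul] at h
    have h2 : 0 < euclNorm x ^ 2 := by positivity
    calc c * euclNorm x ^ 2
        ≤ ((euclNorm x)⁻¹ * ((euclNorm x)⁻¹ * (x ⬝ᵥ P.mulVec x))) * euclNorm x ^ 2 :=
          mul_le_mul_of_nonneg_right h h2.le
      _ = _ := by field_simp

/-- A continuous function `h` that vanishes at `0` and is monotone on the half-line has a
class-`K∞` majorant `α₂`, and some class-`K∞` function `α₃` satisfies `α₃ v ≤ η * r ^ 2`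
whenever `0 ≤ v ≤ α₂ r`. -/
theorem exists_classKInf_of_monotone {h : ℝ → ℝ} (hc : Continuous h)
    (hm : MonotoneOn h (Ici 0)) (h0 : h 0 = 0) {η : ℝ} (hη : 0 < η) :
    ∃ α₂ α₃ : ℝ → ℝ, ClassKInf α₂ ∧ ClassKInf α₃ ∧ (∀ r, 0 ≤ r → h r ≤ α₂ r) ∧
      ∀ r, 0 ≤ r → ∀ v, 0 ≤ v → v ≤ α₂ r → α₃ v ≤ η * r ^ 2 := by
  have hmono : Monotone fun r => h (max r 0) := fun a b hab =>
    hm (le_max_right a 0) (le_max_right b 0) (max_le_max_right 0 hab)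
  let g : ℝ → ℝ := fun r => r + h (max r 0)
  have hg : StrictMono g := strictMono_id.add_monotone hmono
  have hgc : Continuous g := by fun_prop
  have hg0 : g 0 = 0 := by simp [g, h0]
  have htop : Tendsto g atTop atTop := by
    refine tendsto_atTop_mono' atTop ?_ tendsto_id
    filter_upwards [eventually_ge_atTop 0] with r hr
    have : h (max 0 0) ≤ h (max r 0) := hmono hr
    simp only [max_self, h0] at this
    simpa [g] using this
  have hbot : Tendsto g atBot atBot := by
    refine tendsto_atBot_mono' atBot ?_ tendsto_id
    filter_upwards [eventually_le_atBot 0] with r hr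
    simp [g, max_eq_right hr, h0]
  let e : ℝ ≃o ℝ := hg.orderIsoOfSurjective g (hgc.surjective htop hbot)
  have he (r : ℝ) : e r = g r := rfl
  have he0 : e.symm 0 = 0 := by
    rw [OrderIso.symm_apply_eq, he, hg0]
  have hnn {v : ℝ} (hv : 0 ≤ v) : 0 ≤ e.symm v := he0 ▸ e.symm.monotone hv
  refine ⟨g, fun v => η * e.symm v ^ 2,
    ⟨hgc.continuousOn, hg.strictMonoOn _, hg0, htop⟩, ⟨?_, ?_, ?_, ?_⟩, ?_, ?_⟩
  · have := e.symm.continuous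
    fun_prop
  · intro a ha b hb hab
    exact mul_lt_mul_of_pos_left
      (pow_lt_pow_left₀ (e.symm.strictMono hab) (hnn ha) two_ne_zero) hη
  · simp [he0]
  · exact ((tendsto_pow_atTop two_ne_zero).comp e.symm.tendsto_atTop).const_mul_atTop hη
  · intro r hr
    simp [g, hr]
  · intro r hr v hv hvr
    have : e.symm v ≤ r := (OrderIso.symm_apply_le e).2 hvr
    exact mul_le_mul_of_nonneg_left (pow_le_pow_left₀ (hnn hv) this 2) hη.le

/-- Bound on the Lie derivative when the gradient and the dynamics share the selection `-u` of
the regularized nonlinearity. -/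
theorem dotProduct_le_of_lmi {n p : ℕ} {A : Matrix (Fin n) (Fin n) ℝ}
    {B : Matrix (Fin n) (Fin p) ℝ} {C : Matrix (Fin p) (Fin n) ℝ} {z γ : Fin p → ℝ}
    {P : Matrix (Fin n) (Fin n) ℝ} {η : ℝ} (hPsym : P.IsSymm)
    (hM : ∀ v : Fin n ⊕ Fin p → ℝ,
      v ⬝ᵥ (Matrix.fromBlocks
        (P * A + Aᵀ * P + η • (1 : Matrix (Fin n) (Fin n) ℝ))
        (P * B - (C + Matrix.diagonal γ * C * A)ᵀ)
        (Bᵀ * P - (C + Matrix.diagonal γ * C * A))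
        ((-2 : ℝ) • Matrix.diagonal z - Matrix.diagonal γ * C * B
          - (Matrix.diagonal γ * C * B)ᵀ)).mulVec v ≤ 0)
    (x : Fin n → ℝ) (u : Fin p → ℝ) :
    (P.mulVec x + (Cᵀ * Matrix.diagonal γ).mulVec (-u)) ⬝ᵥ (A.mulVec x + B.mulVec u) ≤
      -(η / 2) * euclNorm x ^ 2 + ∑ i, (-u i) * (z i * (-u i) - C.mulVec x i) := by
  have h := hM (Sum.elim x u)
  have hsum : ∑ i, (-u i) * (z i * (-u i) - C.mulVec x i) =
      u ⬝ᵥ (Matrix.diagonal z).mulVec u + u ⬝ᵥ C.mulVec x := by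
    simp only [dotProduct, mulVec_diagonal, ← Finset.sum_add_distrib]
    exact Finset.sum_congr rfl fun i _ => by ring
  have hflip {k l : ℕ} (M : Matrix (Fin k) (Fin l) ℝ) (a : Fin l → ℝ) (b : Fin k → ℝ) :
      a ⬝ᵥ Mᵀ.mulVec b = b ⬝ᵥ M.mulVec a := by
    rw [mulVec_transpose, dotProduct_comm, ← dotProduct_mulVec]
  have hP (a b : Fin n → ℝ) : a ⬝ᵥ P.mulVec b = b ⬝ᵥ P.mulVec a := by
    rw [← hflip, hPsym.eq]
  rw [hsum, euclNorm_sq, dotProduct_comm]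
  simp only [fromBlocks_mulVec, sumElim_dotProduct_sumElim, Sum.elim_comp_inl,
    Sum.elim_comp_inr, add_mulVec, sub_mulVec, smul_mulVec, one_mulVec, transpose_add,
    transpose_mul, diagonal_transpose, ← mulVec_mulVec, dotProduct_add, dotProduct_sub,
    add_dotProduct, dotProduct_smul, smul_eq_mul, mulVec_neg, mulVec_add, dotProduct_neg, hflip] at h ⊢
  have hΓ (a b : Fin p → ℝ) : a ⬝ᵥ (Matrix.diagonal γ).mulVec b =
      (Matrix.diagonal γ).mulVec a ⬝ᵥ b := by
    rw [dotProduct_comm _ b, ← hflip, diagonal_transpose]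
  rw [dotProduct_comm (P.mulVec x) (A.mulVec x), dotProduct_comm (P.mulVec x) (B.mulVec u),
    hP x, hP x, dotProduct_comm _ (A.mulVec x), dotProduct_comm _ (B.mulVec u), hflip, hflip,
    hΓ, hΓ] at h
  linarith

/-- under Assumptions 1 and 2, there are class-`K∞` functions
`α₁, α₂, α₃` sandwiching `V` and bounding its set-valued Lie derivative. -/
theorem stmt2 {n p : ℕ} (A : Matrix (Fin n) (Fin n) ℝ) (B : Matrix (Fin n) (Fin p) ℝ)
    (C : Matrix (Fin p) (Fin n) ℝ) (ψ : Fin p → ℝ → ℝ) (z : Fin p → ℝ)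
    (γ : Fin p → ℝ) (P : Matrix (Fin n) (Fin n) ℝ) (η : ℝ)
    -- Assumption 1
    (hA1 : ∀ i, PiecewiseContinuous (ψ i) ∧ Sector (ψ i) (z i))
    -- Assumption 2
    (hγ : ∀ i, 0 < γ i) (hPsym : P.IsSymm) (hPpos : P.PosDef) (hη : 0 < η)
    (hM : ∀ v : Fin n ⊕ Fin p → ℝ,
      v ⬝ᵥ (Matrix.fromBlocks
        (P * A + Aᵀ * P + η • (1 : Matrix (Fin n) (Fin n) ℝ))
        (P * B - (C + Matrix.diagonal γ * C * A)ᵀ)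
        (Bᵀ * P - (C + Matrix.diagonal γ * C * A))
        ((-2 : ℝ) • Matrix.diagonal z - Matrix.diagonal γ * C * B
          - (Matrix.diagonal γ * C * B)ᵀ)).mulVec v ≤ 0) :
    ∃ α₁ α₂ α₃ : ℝ → ℝ, ClassKInf α₁ ∧ ClassKInf α₂ ∧ ClassKInf α₃ ∧
      (∀ x : Fin n → ℝ,
        α₁ (euclNorm x) ≤ lureV P C γ ψ x ∧ lureV P C γ ψ x ≤ α₂ (euclNorm x)) ∧
      (∀ x : Fin n → ℝ, ∀ a ∈ lieDeriv A B C ψ P (Matrix.diagonal γ) x,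
        a ≤ - α₃ (lureV P C γ ψ x)) := by
  choose hpc hsec using hA1
  have hint i := (hpc i).intervalIntegrable
  obtain ⟨c, hc, hcP⟩ := hPpos.exists_pos_mul_euclNorm_sq_le
  set k : ℝ := ∑ i, ∑ j, |C i j| with hk
  have hk0 : 0 ≤ k := Finset.sum_nonneg fun _ _ => Finset.sum_nonneg fun _ _ => abs_nonneg _
  set q : ℝ := n * ∑ i, ∑ j, |P i j| with hq
  have hq0 : 0 ≤ q := mul_nonneg n.cast_nonneg
    (Finset.sum_nonneg fun _ _ => Finset.sum_nonneg fun _ _ => abs_nonneg _)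
  let h : ℝ → ℝ := fun r => (1 / 2) * (q * r ^ 2) +
    ∑ i, γ i * ((∫ σ in (0 : ℝ)..(k * r), ψ i σ) + ∫ σ in (0 : ℝ)..-(k * r), ψ i σ)
  have hprim i : Continuous fun y => ∫ σ in (0 : ℝ)..y, ψ i σ :=
    intervalIntegral.continuous_primitive (hint i) 0
  have hcont : Continuous h := by
    refine (by fun_prop : Continuous fun r : ℝ => (1 / 2) * (q * r ^ 2)).add
      (continuous_finsetSum _ fun i _ => continuous_const.mul (.add ?_ ?_))
    · exact (hprim i).comp (continuous_const.mul continuous_id)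
    · exact (hprim i).comp (continuous_const.mul continuous_id).neg
  have hmono : MonotoneOn h (Ici 0) := by
    intro a ha b _ hab
    have ha : 0 ≤ k * a := mul_nonneg hk0 ha
    have hkab : k * a ≤ k * b := mul_le_mul_of_nonneg_left hab hk0
    refine add_le_add ?_ (Finset.sum_le_sum fun i _ => mul_le_mul_of_nonneg_left ?_ (hγ i).le)
    · have := pow_le_pow_left₀ ‹a ∈ Ici 0› hab 2
      gcongr
    · exact add_le_add ((hsec i).integral_mono (hint i) ha hkab)
        ((hsec i).integral_neg_mono (hint i) ha hkab)
  obtain ⟨α₂, α₃, hα₂, hα₃, hle, hlie⟩ :=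
    exists_classKInf_of_monotone hcont hmono (by simp [h]) (half_pos hη)
  have hlow x : c / 2 * euclNorm x ^ 2 ≤ lureV P C γ ψ x := by
    have : 0 ≤ ∑ i, γ i * ∫ σ in (0:ℝ)..(C.mulVec x i), ψ i σ :=
      Finset.sum_nonneg fun i _ => mul_nonneg (hγ i).le ((hsec i).primitive_nonneg _)
    unfold lureV
    linarith [hcP x]
  have hup x : lureV P C γ ψ x ≤ α₂ (euclNorm x) := by
    refine le_trans ?_ (hle _ (euclNorm_nonneg x))
    exact add_le_add (mul_le_mul_of_nonneg_left (dotProduct_mulVec_le P x) (by norm_num))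
      (Finset.sum_le_sum fun i _ => mul_le_mul_of_nonneg_left
        ((hsec i).primitive_le (hint i) (abs_mulVec_le C x i)) (hγ i).le)
  refine ⟨fun r => c / 2 * r ^ 2, α₂, α₃, ⟨by fun_prop, ?_, by simp, ?_⟩, hα₂, hα₃,
    fun x => ⟨hlow x, hup x⟩, ?_⟩
  · intro a ha b _ hab
    exact mul_lt_mul_of_pos_left (pow_lt_pow_left₀ hab ha two_ne_zero) (half_pos hc)
  · exact (tendsto_pow_atTop two_ne_zero).const_mul_atTop (half_pos hc)
  · rintro x a ⟨f, ⟨u, hu, rfl⟩, hf⟩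
    rw [← hf _ ⟨-u, hu, rfl⟩]
    have hsum : ∑ i, (-u i) * (z i * (-u i) - C.mulVec x i) ≤ 0 :=
      Finset.sum_nonpos fun i _ => (hsec i).kras (hu i)
    have hV : 0 ≤ lureV P C γ ψ x := le_trans (by positivity) (hlow x)
    linarith [dotProduct_le_of_lmi hPsym hM x u,
      hlie _ (euclNorm_nonneg x) _ hV (hup x)]
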